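/- arXiv:2403.15608 — 3 statements merged into one kernel-verified Lean document; each statement's English description precedes it below -/
import Mathlib

section
/- Let H > 0 be a real number with P̄(H) = 0. Then dim_H(F) ≤ H, where dim_H denotes Hausdorff dimension. -/
open Filter

/-- The weight `c_ω` of a word `ω` over the alphabet `{0,1}` (here `false` is the
letter 0 and `true` is the letter 1): the product of `c0` over letters 0 and `c1`
over letters 1. -/
noncomputable def wt (c0 c1 : ℝ) (w : List Bool) : ℝ :=
  (w.map fun b => if b then c1 else c0).prod

/-- All words of length `n` over the alphabet `{0,1}`. -/
def allWords : ℕ → Finset (List Bool)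
  | 0 => {[]}
  | n + 1 => (allWords n).biUnion fun w => {false :: w, true :: w}

/-- Membership in the language of the S-gap shift: every maximal block of 0s lying
strictly between two 1s has length in `S`. -/
def InLang (S : Set ℕ) (w : List Bool) : Prop :=
  ∀ u v : List Bool, ∀ m : ℕ,
    w = u ++ [true] ++ List.replicate m false ++ [true] ++ v → m ∈ S

/-- Membership in the core set `G`: words of the form `0^{s₁}1 0^{s₂}1 ⋯ 0^{s_k}1`
with `k ≥ 1` and every `s_i ∈ S`. -/
def InCore (S : Set ℕ) (w : List Bool) : Prop :=
  ∃ bs : List ℕ, bs ≠ [] ∧ (∀ s ∈ bs, s ∈ S) ∧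
    w = (bs.map fun s => List.replicate s false ++ [true]).flatten

/-- `L_n`: the words of length `n` in the language of the S-gap shift. -/
noncomputable def langWords (S : Set ℕ) (n : ℕ) : Finset (List Bool) :=
  @Finset.filter _ (InLang S) (Classical.decPred _) (allWords n)

/-- `G_n`: the core words of length `n`. -/
noncomputable def coreWords (S : Set ℕ) (n : ℕ) : Finset (List Bool) :=
  @Finset.filter _ (InCore S) (Classical.decPred _) (allWords n)

/-- The composition `f_{ω₁} ∘ f_{ω₂} ∘ ⋯ ∘ f_{ω_n}` for a word `ω = ω₁⋯ω_n`
(`false` is the letter 0, giving `f0`; `true` is the letter 1, giving `f1`). -/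
def compMap {X : Type*} (f0 f1 : X → X) (w : List Bool) : X → X :=
  w.foldr (fun b g => (if b then f1 else f0) ∘ g) id

/-- The initial segment `ω₁⋯ω_n` of an infinite sequence. -/
def seqPrefix (ω : ℕ → Bool) (n : ℕ) : List Bool := (List.range n).map ω

/-- The positions of the 1s in the sequence `0^n 1 0^{g 0} 1 0^{g 1} 1 ⋯`. -/
def onesPos (n : ℕ) (g : ℕ → ℕ) : ℕ → ℕ
  | 0 => n
  | k + 1 => onesPos n g k + g k + 1

/-- The sequence `0^n 1 0^{g 0} 1 0^{g 1} 1 ⋯`. -/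
noncomputable def buildSeq (n : ℕ) (g : ℕ → ℕ) (i : ℕ) : Bool :=
  @decide (∃ k, onesPos n g k = i) (Classical.propDecidable _)

/-- The S-gap shift `X(S)`: the closure (in the product topology on `{0,1}^ℕ`) of
the set of sequences `0^n 1 0^{s₁} 1 0^{s₂} 1 ⋯` with `n ∈ ℕ` and every `s_i ∈ S`. -/
def XS (S : Set ℕ) : Set (ℕ → Bool) :=
  closure {ω | ∃ (n : ℕ) (g : ℕ → ℕ), (∀ k, g k ∈ S) ∧ ω = buildSeq n g}

open MeasureTheory Topology

theorem wt_cons (c0 c1 : ℝ) (a : Bool) (w : List Bool) :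
    wt c0 c1 (a :: w) = (if a then c1 else c0) * wt c0 c1 w := by
  simp [wt]

theorem wt_pos {c0 c1 : ℝ} (h0 : 0 < c0) (h1 : 0 < c1) (w : List Bool) : 0 < wt c0 c1 w := by
  induction w with
  | nil => simp [wt]
  | cons a w ih =>
    rw [wt_cons]
    cases a <;> simp <;> positivity

theorem wt_le_pow {c0 c1 b : ℝ} (h0 : 0 < c0) (h1 : 0 < c1) (h0b : c0 ≤ b) (h1b : c1 ≤ b)
    (w : List Bool) : wt c0 c1 w ≤ b ^ w.length := by
  induction w with
  | nil => simp [wt]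
  | cons a w ih =>
    rw [wt_cons, List.length_cons, pow_succ']
    have hab : (if a then c1 else c0) ≤ b := by cases a <;> simpa
    exact mul_le_mul hab ih (wt_pos h0 h1 w).le (h0.le.trans h0b)

theorem mem_allWords {n : ℕ} {w : List Bool} : w ∈ allWords n ↔ w.length = n := by
  induction n generalizing w with
  | zero => simp [allWords]
  | succ n ih =>
    cases w with
    | nil => simp [allWords]
    | cons a w => cases a <;> simp [allWords, ih]

theorem mem_langWords {S : Set ℕ} {n : ℕ} {w : List Bool} :
    w ∈ langWords S n ↔ w.length = n ∧ InLang S w := by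
  simp [langWords, mem_allWords]

theorem seqPrefix_getElem? (ω : ℕ → Bool) (n i : ℕ) :
    (seqPrefix ω n)[i]? = if i < n then some (ω i) else none := by
  simp only [seqPrefix, List.getElem?_map]
  split_ifs with h
  · rw [List.getElem?_range h]; rfl
  · rw [List.getElem?_eq_none (by simpa using h)]; rfl

theorem strictMono_onesPos (n : ℕ) (g : ℕ → ℕ) : StrictMono (onesPos n g) :=
  strictMono_nat_of_lt_succ fun k => by simp only [onesPos]; omega

theorem buildSeq_eq_true_iff {n : ℕ} {g : ℕ → ℕ} {i : ℕ} :
    buildSeq n g i = true ↔ ∃ k, onesPos n g k = i := by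
  simp [buildSeq]

theorem inLang_seqPrefix_buildSeq {S : Set ℕ} {g : ℕ → ℕ} (hg : ∀ k, g k ∈ S) (n N : ℕ) :
    InLang S (seqPrefix (buildSeq n g) N) := by
  intro u v m h
  have key : ∀ i x, (u ++ [true] ++ List.replicate m false ++ [true] ++ v)[i]? = some x →
      buildSeq n g i = x := by
    intro i x hx
    rw [← h, seqPrefix_getElem?] at hx
    split_ifs at hx
    simpa using hx
  obtain ⟨k, hk⟩ := buildSeq_eq_true_iff.1 (key u.length true (by simp))
  obtain ⟨j, hj⟩ := buildSeq_eq_true_iff.1 (key (u.length + m + 1) true (by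
    rw [List.getElem?_append_left (by simp; omega), List.getElem?_append_right (by simp; omega)]
    have : u.length + m + 1 - (u ++ [true] ++ List.replicate m false).length = 0 := by
      simp
    rw [this]; rfl))
  have hzero : ∀ i, u.length < i → i < u.length + m + 1 → buildSeq n g i = false := by
    intro i h1 h2
    apply key
    rw [List.getElem?_append_left (by simp; omega), List.getElem?_append_left (by simp; omega),
      List.getElem?_append_right (by simp; omega), List.getElem?_replicate, if_pos]
    simp; omega
  have hkj : k < j := (strictMono_onesPos n g).lt_iff_lt.1 (by omega)
  have hle : onesPos n g (k + 1) ≤ onesPos n g j :=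
    (strictMono_onesPos n g).monotone hkj
  have hsucc : onesPos n g (k + 1) = onesPos n g k + g k + 1 := rfl
  have hge : ¬ onesPos n g (k + 1) < u.length + m + 1 := fun hlt => by
    have h1 := hzero _ (by omega) hlt
    rw [buildSeq_eq_true_iff.2 ⟨k + 1, rfl⟩] at h1
    exact absurd h1 (by simp)
  have : m = g k := by omega
  exact this ▸ hg k

theorem seqPrefix_mem_langWords {S : Set ℕ} {ω : ℕ → Bool} (hω : ω ∈ XS S) (N : ℕ) :
    seqPrefix ω N ∈ langWords S N := by
  refine mem_langWords.2 ⟨by simp [seqPrefix], ?_⟩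
  have hU : (Set.Iio N).pi (fun i => {ω i}) ∈ 𝓝 ω :=
    set_pi_mem_nhds (Set.finite_Iio N) fun i _ => by simp
  obtain ⟨ω', hω', n, g, hg, rfl⟩ := mem_closure_iff_nhds.1 hω _ hU
  have : seqPrefix ω N = seqPrefix (buildSeq n g) N :=
    List.map_congr_left fun i hi => (hω' i (by simpa using hi)).symm
  exact this ▸ inLang_seqPrefix_buildSeq hg n N

theorem compMap_mem {X : Type*} {f0 f1 : X → X} {K : Set X}
    (h0K : f0 '' K ⊆ K) (h1K : f1 '' K ⊆ K) (w : List Bool) {x : X}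
    (hx : x ∈ K) : compMap f0 f1 w x ∈ K := by
  induction w with
  | nil => exact hx
  | cons a w ih =>
    cases a
    · exact h0K ⟨_, ih, rfl⟩
    · exact h1K ⟨_, ih, rfl⟩

section compMap

variable {X : Type*} [PseudoMetricSpace X] {f0 f1 : X → X} {K : Set X} {c0 c1 : ℝ}

theorem dist_compMap_le (h0 : 0 ≤ c0) (h1 : 0 ≤ c1) (h0K : f0 '' K ⊆ K) (h1K : f1 '' K ⊆ K)
    (hf0 : ∀ x ∈ K, ∀ y ∈ K, dist (f0 x) (f0 y) ≤ c0 * dist x y)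
    (hf1 : ∀ x ∈ K, ∀ y ∈ K, dist (f1 x) (f1 y) ≤ c1 * dist x y)
    (w : List Bool) {x y : X} (hx : x ∈ K) (hy : y ∈ K) :
    dist (compMap f0 f1 w x) (compMap f0 f1 w y) ≤ wt c0 c1 w * dist x y := by
  induction w with
  | nil => simp [compMap, wt]
  | cons a w ih =>
    have hx' := compMap_mem h0K h1K w hx
    have hy' := compMap_mem h0K h1K w hy
    rw [wt_cons, mul_assoc]
    cases a
    · exact (hf0 _ hx' _ hy').trans (mul_le_mul_of_nonneg_left ih h0)
    · exact (hf1 _ hx' _ hy').trans (mul_le_mul_of_nonneg_left ih h1)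

theorem ediam_compMap_image_le (h0 : 0 < c0) (h1 : 0 < c1)
    (h0K : f0 '' K ⊆ K) (h1K : f1 '' K ⊆ K)
    (hf0 : ∀ x ∈ K, ∀ y ∈ K, dist (f0 x) (f0 y) ≤ c0 * dist x y)
    (hf1 : ∀ x ∈ K, ∀ y ∈ K, dist (f1 x) (f1 y) ≤ c1 * dist x y)
    (hK : Bornology.IsBounded K) (w : List Bool) :
    Metric.ediam (compMap f0 f1 w '' K) ≤ ENNReal.ofReal (wt c0 c1 w * Metric.diam K) := by
  apply Metric.ediam_le_of_forall_dist_le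
  rintro _ ⟨x, hx, rfl⟩ _ ⟨y, hy, rfl⟩
  exact (dist_compMap_le h0.le h1.le h0K h1K hf0 hf1 w hx hy).trans
    (mul_le_mul_of_nonneg_left (Metric.dist_le_diam_of_mem hK hx hy) (wt_pos h0 h1 w).le)

end compMap

/-- If the pressure vanishes at `H`, the partition sums with exponent `t > H` tend to `0`. -/
theorem tendsto_sum_wt_rpow_zero {S : Set ℕ} {c0 c1 H t : ℝ}
    (h0 : 0 < c0) (h1 : 0 < c1) (h0' : c0 < 1) (h1' : c1 < 1)
    (hP : Tendsto (fun n : ℕ => (1 / (n : ℝ)) * Real.log (∑ ω ∈ langWords S n, wt c0 c1 ω ^ H))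
      atTop (𝓝 0)) (ht : H < t) :
    Tendsto (fun n : ℕ => ∑ ω ∈ langWords S n, wt c0 c1 ω ^ t) atTop (𝓝 0) := by
  set b := max c0 c1 with hb
  have hb0 : 0 < b := lt_max_of_lt_left h0
  have hb1 : b < 1 := max_lt h0' h1'
  have hneg : (t - H) * Real.log b < 0 :=
    mul_neg_of_pos_of_neg (sub_pos.2 ht) (Real.log_neg hb0 hb1)
  have hexp : Tendsto (fun n : ℕ => Real.exp ((n : ℝ) * ((t - H) * Real.log b +
      (1 / (n : ℝ)) * Real.log (∑ ω ∈ langWords S n, wt c0 c1 ω ^ H)))) atTop (𝓝 0) := by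
    refine Real.tendsto_exp_atBot.comp ?_
    refine Tendsto.atTop_mul_neg (C := (t - H) * Real.log b) hneg
      tendsto_natCast_atTop_atTop ?_
    simpa using tendsto_const_nhds.add hP
  refine squeeze_zero' (Eventually.of_forall fun n =>
    Finset.sum_nonneg fun w _ => Real.rpow_nonneg (wt_pos h0 h1 w).le _) ?_ hexp
  filter_upwards [eventually_gt_atTop 0] with n hn
  have hn' : (n : ℝ) ≠ 0 := by exact_mod_cast hn.ne'
  have hexpand : (n : ℝ) * ((t - H) * Real.log b +
      (1 / (n : ℝ)) * Real.log (∑ ω ∈ langWords S n, wt c0 c1 ω ^ H)) =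
      Real.log b * (n * (t - H)) + Real.log (∑ ω ∈ langWords S n, wt c0 c1 ω ^ H) := by
    field_simp
  rw [hexpand, Real.exp_add, ← Real.rpow_def_of_pos hb0, Real.rpow_mul hb0.le, Real.rpow_natCast]
  calc ∑ ω ∈ langWords S n, wt c0 c1 ω ^ t
      ≤ ∑ ω ∈ langWords S n, (b ^ n) ^ (t - H) * wt c0 c1 ω ^ H := by
        refine Finset.sum_le_sum fun w hw => ?_
        have hw0 := wt_pos h0 h1 w
        have hwb := wt_le_pow h0 h1 (le_max_left c0 c1) (le_max_right c0 c1) w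
        rw [(mem_langWords.1 hw).1] at hwb
        calc wt c0 c1 w ^ t = wt c0 c1 w ^ (t - H) * wt c0 c1 w ^ H := by
              rw [← Real.rpow_add hw0, sub_add_cancel]
          _ ≤ (b ^ n) ^ (t - H) * wt c0 c1 w ^ H := by
              gcongr
    _ = (b ^ n) ^ (t - H) * ∑ ω ∈ langWords S n, wt c0 c1 ω ^ H := by rw [Finset.mul_sum]
    _ ≤ _ := by
        gcongr
        exact Real.le_exp_log _


/-- If H > 0 and P̄(H) = 0, then dim_H(F) ≤ H where F = π(X(S)). -/
theorem stmt11
    (S : Set ℕ) (hS : S.Infinite)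
    (c0 c1 cb0 cb1 : ℝ)
    (hc0 : 0 < c0) (hc0b : c0 ≤ cb0) (hcb0 : cb0 < 1)
    (hc1 : 0 < c1) (hc1b : c1 ≤ cb1) (hcb1 : cb1 < 1)
    (P Pb : ℝ → ℝ)
    (hP : ∀ t : ℝ, Filter.Tendsto
      (fun n : ℕ => (1 / (n : ℝ)) * Real.log (∑ ω ∈ langWords S n, wt c0 c1 ω ^ t))
      Filter.atTop (nhds (P t)))
    (hPb : ∀ t : ℝ, Filter.Tendsto
      (fun n : ℕ => (1 / (n : ℝ)) * Real.log (∑ ω ∈ langWords S n, wt cb0 cb1 ω ^ t))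
      Filter.atTop (nhds (Pb t)))
    (d : ℕ)
    (K : Set (EuclideanSpace ℝ (Fin d))) (hKne : K.Nonempty) (hKcomp : IsCompact K)
    (f0 f1 : EuclideanSpace ℝ (Fin d) → EuclideanSpace ℝ (Fin d))
    (hf0K : f0 '' K ⊆ K) (hf1K : f1 '' K ⊆ K)
    (hf0 : ∀ x ∈ K, ∀ y ∈ K,
      c0 * ‖x - y‖ ≤ ‖f0 x - f0 y‖ ∧ ‖f0 x - f0 y‖ ≤ cb0 * ‖x - y‖)
    (hf1 : ∀ x ∈ K, ∀ y ∈ K,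
      c1 * ‖x - y‖ ≤ ‖f1 x - f1 y‖ ∧ ‖f1 x - f1 y‖ ≤ cb1 * ‖x - y‖)
    (V : Set (EuclideanSpace ℝ (Fin d))) (hVopen : IsOpen V) (hVne : V.Nonempty)
    (hVK : closure V ⊆ K)
    (hOSC1 : f0 '' V ∪ f1 '' V ⊆ V) (hOSC2 : f0 '' V ∩ f1 '' V = ∅)
    (π : (ℕ → Bool) → EuclideanSpace ℝ (Fin d))
    (hπ : ∀ ω ∈ XS S, (⋂ n : ℕ, compMap f0 f1 (seqPrefix ω (n + 1)) '' K) = {π ω})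
    (H : ℝ) (hH : 0 < H) (hPH : Pb H = 0) :
    dimH (π '' XS S) ≤ ENNReal.ofReal H := by
  have h0 : 0 < cb0 := hc0.trans_le hc0b
  have h1 : 0 < cb1 := hc1.trans_le hc1b
  refine dimH_le fun t htop => ?_
  by_contra! hlt
  have ht : H < t := by
    rw [← ENNReal.ofReal_coe_nnreal] at hlt
    exact (ENNReal.ofReal_lt_ofReal_iff_of_nonneg hH.le).1 hlt
  have ht0 : (0 : ℝ) < t := hH.trans ht
  have hsum := (tendsto_sum_wt_rpow_zero h0 h1 hcb0 hcb1 (hPH ▸ hPb H) ht).comp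
    (tendsto_add_atTop_nat 1)
  have hdiam := ediam_compMap_image_le h0 h1 hf0K hf1K
    (fun x hx y hy => by simpa only [dist_eq_norm] using (hf0 x hx y hy).2)
    (fun x hx y hy => by simpa only [dist_eq_norm] using (hf1 x hx y hy).2) hKcomp.isBounded
  set D := Metric.diam K
  have hD : 0 ≤ D := Metric.diam_nonneg
  set b := max cb0 cb1
  have hb0 : 0 ≤ b := h0.le.trans (le_max_left _ _)
  have hr : Tendsto (fun n : ℕ => ENNReal.ofReal (b ^ (n + 1) * D)) atTop (𝓝 0) := by
    rw [← ENNReal.ofReal_zero]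
    refine ENNReal.tendsto_ofReal ?_
    simpa using ((tendsto_pow_atTop_nhds_zero_of_lt_one hb0 (max_lt hcb0 hcb1)).comp
      (tendsto_add_atTop_nat 1)).mul_const D
  have hle := Measure.hausdorffMeasure_le_liminf_sum (ι := fun n : ℕ => langWords S (n + 1))
    (t : ℝ) (π '' XS S) _ hr
    (fun n w => compMap f0 f1 w.1 '' K)
    (Eventually.of_forall fun n w => (hdiam w.1).trans <| ENNReal.ofReal_le_ofReal <| by
      have hwb := wt_le_pow h0 h1 (le_max_left cb0 cb1) (le_max_right cb0 cb1) w.1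
      rw [(mem_langWords.1 w.2).1] at hwb
      exact mul_le_mul_of_nonneg_right hwb hD)
    (Eventually.of_forall fun n => by
      rintro _ ⟨ω, hω, rfl⟩
      have hmem : π ω ∈ ⋂ n : ℕ, compMap f0 f1 (seqPrefix ω (n + 1)) '' K := by
        rw [hπ ω hω]; rfl
      exact Set.mem_iUnion.2 ⟨⟨_, seqPrefix_mem_langWords hω (n + 1)⟩, Set.mem_iInter.1 hmem n⟩)
  have hlim : Tendsto (fun n : ℕ => ∑ w : langWords S (n + 1),
      Metric.ediam (compMap f0 f1 w.1 '' K) ^ (t : ℝ)) atTop (𝓝 0) := by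
    have hub : Tendsto (fun n : ℕ => ENNReal.ofReal
        ((∑ w ∈ langWords S (n + 1), wt cb0 cb1 w ^ (t : ℝ)) * D ^ (t : ℝ))) atTop (𝓝 0) := by
      rw [← ENNReal.ofReal_zero]
      refine ENNReal.tendsto_ofReal ?_
      simpa using hsum.mul_const (D ^ (t : ℝ))
    refine tendsto_of_tendsto_of_tendsto_of_le_of_le tendsto_const_nhds hub
      (fun n => zero_le) fun n => ?_
    rw [Finset.sum_coe_sort (langWords S (n + 1))
      (fun w => Metric.ediam (compMap f0 f1 w '' K) ^ (t : ℝ)), Finset.sum_mul,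
      ENNReal.ofReal_sum_of_nonneg fun w _ =>
        mul_nonneg (Real.rpow_nonneg (wt_pos h0 h1 w).le _) (Real.rpow_nonneg hD _)]
    refine Finset.sum_le_sum fun w _ => ?_
    rw [← Real.mul_rpow (wt_pos h0 h1 w).le hD,
      ← ENNReal.ofReal_rpow_of_nonneg (mul_nonneg (wt_pos h0 h1 w).le hD) ht0.le]
    exact ENNReal.rpow_le_rpow (hdiam w) ht0.le
  rw [hlim.liminf_eq, htop] at hle
  exact absurd hle (by simp)
end

section
/- Every word w in the language L can be written as a concatenation w = u · γ · 0^k for some k ∈ ℕ, where u is either the empty word or a word of the form 0^m 1 with m ∉ S, and γ is either the empty word or a word in the core set G. -/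
open Filter

/-- Every word is a concatenation of blocks `0^s 1` followed by a run of 0s. -/
theorem exists_blocks_append_replicate (w : List Bool) :
    ∃ (bs : List ℕ) (k : ℕ),
      w = (bs.map fun s => List.replicate s false ++ [true]).flatten ++
        List.replicate k false := by
  induction w with
  | nil => exact ⟨[], 0, rfl⟩
  | cons b w ih =>
    obtain ⟨bs, k, rfl⟩ := ih
    cases b with
    | true => exact ⟨0 :: bs, k, by simp⟩
    | false =>
      cases bs with
      | nil => exact ⟨[], k + 1, by simp [List.replicate_succ]⟩
      | cons s bs => exact ⟨(s + 1) :: bs, k, by simp [List.replicate_succ]⟩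

/-- In a word of the language, all blocks `0^s 1` that follow a letter 1 have `s ∈ S`. -/
theorem InLang.mem_of_mem_blocks {S : Set ℕ} {z : List Bool} {bs : List ℕ} {p : List Bool}
    (h : InLang S (p ++ [true] ++
      (bs.map fun s => List.replicate s false ++ [true]).flatten ++ z)) :
    ∀ s ∈ bs, s ∈ S := by
  induction bs generalizing p with
  | nil => simp
  | cons b bs ih =>
    refine List.forall_mem_cons.2
      ⟨h p ((bs.map fun s => List.replicate s false ++ [true]).flatten ++ z) b (by simp), ?_⟩
    exact ih (p := p ++ [true] ++ List.replicate b false) (by simpa using h)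

/-- Every word w in the language L can be written as w = u · γ · 0^k
where u is empty or of the form 0^m1 with m ∉ S, and γ is empty or a core word. -/
theorem stmt14 (S : Set ℕ) (hS : S.Infinite) :
    ∀ w : List Bool, InLang S w →
      ∃ (u γ : List Bool) (k : ℕ),
        w = u ++ γ ++ List.replicate k false ∧
        (u = [] ∨ ∃ m : ℕ, m ∉ S ∧ u = List.replicate m false ++ [true]) ∧
        (γ = [] ∨ InCore S γ) := by
  intro w hw
  obtain ⟨bs, k, rfl⟩ := exists_blocks_append_replicate w
  cases bs with
  | nil => exact ⟨[], [], k, by simp, Or.inl rfl, Or.inl rfl⟩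
  | cons b bs =>
    have hbs : ∀ s ∈ bs, s ∈ S :=
      InLang.mem_of_mem_blocks (p := List.replicate b false) (z := List.replicate k false)
        (by simpa using hw)
    by_cases hb : b ∈ S
    · exact ⟨[], _, k, rfl, Or.inl rfl,
        Or.inr ⟨b :: bs, by simp, List.forall_mem_cons.2 ⟨hb, hbs⟩, rfl⟩⟩
    · refine ⟨List.replicate b false ++ [true],
        (bs.map fun s => List.replicate s false ++ [true]).flatten, k, by simp,
        Or.inr ⟨b, hb, rfl⟩, ?_⟩
      rcases eq_or_ne bs [] with rfl | hne
      · exact Or.inl rfl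
      · exact Or.inr ⟨bs, hne, hbs, rfl⟩
end

section
/- There exist unique real numbers h > 0 and H > 0 such that ∑_{s ∈ S} c₀^{s·h}·c₁^h = 1 and ∑_{s ∈ S} c̄₀^{s·H}·c̄₁^H = 1 (sums taken in [0,∞]); moreover h ≤ H. -/
open Filter Topology

theorem summable_rpow_mul_rpow (S : Set ℕ) {a b h : ℝ} (ha : 0 < a) (ha1 : a < 1) (hh : 0 < h) :
    Summable fun s : S => a ^ (((s : ℕ) : ℝ) * h) * b ^ h := by
  have hgeom : Summable fun n : ℕ => (a ^ h) ^ n :=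
    summable_geometric_of_lt_one (by positivity) (Real.rpow_lt_one ha.le ha1 hh)
  have hpow : (fun n : ℕ => (a ^ h) ^ n) = fun n : ℕ => a ^ ((n : ℝ) * h) := by
    ext n
    rw [mul_comm, Real.rpow_mul ha.le, Real.rpow_natCast]
  rw [hpow] at hgeom
  exact (hgeom.subtype S).mul_right _

theorem tsum_ofReal_rpow_mul_rpow_eq_one_iff (S : Set ℕ) {a b h : ℝ} (ha : 0 < a) (ha1 : a < 1)
    (hb : 0 < b) (hh : 0 < h) :
    ∑' s : S, ENNReal.ofReal (a ^ (((s : ℕ) : ℝ) * h) * b ^ h) = 1 ↔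
      ∑' s : S, a ^ (((s : ℕ) : ℝ) * h) * b ^ h = 1 := by
  rw [← ENNReal.ofReal_tsum_of_nonneg (fun s => by positivity)
    (summable_rpow_mul_rpow S ha ha1 hh), ENNReal.ofReal_eq_one]

theorem strictAntiOn_tsum_rpow_mul_rpow {S : Set ℕ} (hS : S.Nonempty) {a b : ℝ}
    (ha : 0 < a) (ha1 : a < 1) (hb : 0 < b) (hb1 : b < 1) :
    StrictAntiOn (fun h : ℝ => ∑' s : S, a ^ (((s : ℕ) : ℝ) * h) * b ^ h) (Set.Ioi 0) := by
  intro x hx y hy hxy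
  have hlt (s : S) : a ^ (((s : ℕ) : ℝ) * y) * b ^ y < a ^ (((s : ℕ) : ℝ) * x) * b ^ x := by
    have h1 : a ^ (((s : ℕ) : ℝ) * y) ≤ a ^ (((s : ℕ) : ℝ) * x) :=
      Real.rpow_le_rpow_of_exponent_ge ha ha1.le (by gcongr)
    have h2 : b ^ y < b ^ x := Real.rpow_lt_rpow_of_exponent_gt hb hb1 hxy
    exact mul_lt_mul' h1 h2 (by positivity) (by positivity)
  obtain ⟨s, hs⟩ := hS
  exact Summable.tsum_lt_tsum (i := ⟨s, hs⟩) (fun s => (hlt s).le) (hlt _)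
    (summable_rpow_mul_rpow S ha ha1 hy) (summable_rpow_mul_rpow S ha ha1 hx)

theorem continuousOn_tsum_rpow_mul_rpow (S : Set ℕ) {a b ε : ℝ} (ha : 0 < a) (ha1 : a < 1)
    (hb : 0 < b) (hb1 : b < 1) (hε : 0 < ε) :
    ContinuousOn (fun h : ℝ => ∑' s : S, a ^ (((s : ℕ) : ℝ) * h) * b ^ h) (Set.Ici ε) := by
  refine continuousOn_tsum (u := fun s : S => a ^ (((s : ℕ) : ℝ) * ε) * b ^ ε) (fun s => ?_)
    (summable_rpow_mul_rpow S ha ha1 hε) (fun s x hx => ?_)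
  · exact Continuous.continuousOn ((Real.continuous_const_rpow ha.ne').comp
      (continuous_const.mul continuous_id) |>.mul (Real.continuous_const_rpow hb.ne'))
  · rw [Real.norm_of_nonneg (by positivity)]
    have hx : ε ≤ x := hx
    exact mul_le_mul (Real.rpow_le_rpow_of_exponent_ge ha ha1.le (by gcongr))
      (Real.rpow_le_rpow_of_exponent_ge hb hb1.le hx) (by positivity) (by positivity)

theorem exists_one_lt_tsum_rpow_mul_rpow {S : Set ℕ} (hS : S.Infinite) {a b : ℝ}
    (ha : 0 < a) (ha1 : a < 1) (hb : 0 < b) :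
    ∃ h : ℝ, 0 < h ∧ 1 < ∑' s : S, a ^ (((s : ℕ) : ℝ) * h) * b ^ h := by
  have : Infinite S := hS.to_subtype
  obtain ⟨T, hT⟩ := Infinite.exists_subset_card_eq S 2
  have hcont : Continuous fun h : ℝ => ∑ s ∈ T, a ^ (((s : ℕ) : ℝ) * h) * b ^ h :=
    continuous_finsetSum _ fun s _ => ((Real.continuous_const_rpow ha.ne').comp
      (continuous_const.mul continuous_id)).mul (Real.continuous_const_rpow hb.ne')
  have hev : ∀ᶠ h in 𝓝[>] (0 : ℝ), 1 < ∑ s ∈ T, a ^ (((s : ℕ) : ℝ) * h) * b ^ h :=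
    nhdsWithin_le_nhds (hcont.continuousAt.eventually_const_lt (by simp [hT]))
  obtain ⟨h, hsum, hh⟩ := (hev.and self_mem_nhdsWithin).exists
  exact ⟨h, hh, hsum.trans_le
    ((summable_rpow_mul_rpow S ha ha1 hh).sum_le_tsum T fun s _ => by positivity)⟩

theorem tendsto_tsum_rpow_mul_rpow_atTop (S : Set ℕ) {a b : ℝ} (ha : 0 < a) (ha1 : a < 1)
    (hb : 0 < b) (hb1 : b < 1) :
    Tendsto (fun h : ℝ => ∑' s : S, a ^ (((s : ℕ) : ℝ) * h) * b ^ h) atTop (𝓝 0) := by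
  have hlim : Tendsto (fun h : ℝ => (∑' s : S, a ^ (((s : ℕ) : ℝ) * 1) * b ^ (1 : ℝ)) * b ^ (h - 1))
      atTop (𝓝 0) := by
    simpa [sub_eq_add_neg] using ((tendsto_rpow_atTop_of_base_lt_one b (by linarith) hb1).comp
      (tendsto_atTop_add_const_right atTop (-1 : ℝ) tendsto_id)).const_mul
      (∑' s : S, a ^ (((s : ℕ) : ℝ) * 1) * b ^ (1 : ℝ))
  refine squeeze_zero' (.of_forall fun h => tsum_nonneg fun s => by positivity) ?_ hlim
  filter_upwards [eventually_ge_atTop 1] with h hh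
  rw [← tsum_mul_right]
  refine Summable.tsum_le_tsum (fun s => ?_) (summable_rpow_mul_rpow S ha ha1 (by linarith))
    ((summable_rpow_mul_rpow S ha ha1 one_pos).mul_right _)
  rw [mul_assoc, ← Real.rpow_add hb, add_sub_cancel]
  gcongr ?_ * _
  exact Real.rpow_le_rpow_of_exponent_ge ha ha1.le (by gcongr)

theorem existsUnique_tsum_rpow_mul_rpow_eq_one {S : Set ℕ} (hS : S.Infinite) {a b : ℝ}
    (ha : 0 < a) (ha1 : a < 1) (hb : 0 < b) (hb1 : b < 1) :
    ∃! h : ℝ, 0 < h ∧ ∑' s : S, ENNReal.ofReal (a ^ (((s : ℕ) : ℝ) * h) * b ^ h) = 1 := by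
  obtain ⟨ε, hε, hlow⟩ := exists_one_lt_tsum_rpow_mul_rpow hS ha ha1 hb
  obtain ⟨M, hM, hεM⟩ := (((tendsto_tsum_rpow_mul_rpow_atTop S ha ha1 hb hb1).eventually_lt_const
    one_pos).and (eventually_ge_atTop ε)).exists
  obtain ⟨h, hmem, heq⟩ := intermediate_value_Icc' hεM
    ((continuousOn_tsum_rpow_mul_rpow S ha ha1 hb hb1 hε).mono Set.Icc_subset_Ici_self)
    ⟨hM.le, hlow.le⟩
  have hh : 0 < h := hε.trans_le hmem.1
  refine ⟨h, ⟨hh, (tsum_ofReal_rpow_mul_rpow_eq_one_iff S ha ha1 hb hh).2 heq⟩, ?_⟩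
  rintro y ⟨hy, hy1⟩
  exact (strictAntiOn_tsum_rpow_mul_rpow hS.nonempty ha ha1 hb hb1).injOn hy hh
    (((tsum_ofReal_rpow_mul_rpow_eq_one_iff S ha ha1 hb hy).1 hy1).trans heq.symm)

/-- There exist unique reals h > 0 and H > 0 with
∑_{s ∈ S} c₀^{s·h}·c₁^h = 1 and ∑_{s ∈ S} c̄₀^{s·H}·c̄₁^H = 1 (sums in [0,∞]);
moreover h ≤ H. -/
theorem stmt18
    (S : Set ℕ) (hS : S.Infinite)
    (c0 c1 cb0 cb1 : ℝ)
    (hc0 : 0 < c0) (hc0b : c0 ≤ cb0) (hcb0 : cb0 < 1)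
    (hc1 : 0 < c1) (hc1b : c1 ≤ cb1) (hcb1 : cb1 < 1) :
    (∃! h : ℝ, 0 < h ∧
      ∑' s : S, ENNReal.ofReal (c0 ^ (((s : ℕ) : ℝ) * h) * c1 ^ h) = 1) ∧
    (∃! H : ℝ, 0 < H ∧
      ∑' s : S, ENNReal.ofReal (cb0 ^ (((s : ℕ) : ℝ) * H) * cb1 ^ H) = 1) ∧
    (∀ h H : ℝ,
      (0 < h ∧ ∑' s : S, ENNReal.ofReal (c0 ^ (((s : ℕ) : ℝ) * h) * c1 ^ h) = 1) →
      (0 < H ∧ ∑' s : S, ENNReal.ofReal (cb0 ^ (((s : ℕ) : ℝ) * H) * cb1 ^ H) = 1) →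
      h ≤ H) := by
  have hc0' := hc0b.trans_lt hcb0
  have hc1' := hc1b.trans_lt hcb1
  have hcb0' := hc0.trans_le hc0b
  have hcb1' := hc1.trans_le hc1b
  refine ⟨existsUnique_tsum_rpow_mul_rpow_eq_one hS hc0 hc0' hc1 hc1',
    existsUnique_tsum_rpow_mul_rpow_eq_one hS hcb0' hcb0 hcb1' hcb1, ?_⟩
  rintro h H ⟨hh, hsum⟩ ⟨hH, hSum⟩
  rw [tsum_ofReal_rpow_mul_rpow_eq_one_iff S hc0 hc0' hc1 hh] at hsum
  rw [tsum_ofReal_rpow_mul_rpow_eq_one_iff S hcb0' hcb0 hcb1' hH] at hSum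
  by_contra! hlt
  have hanti := strictAntiOn_tsum_rpow_mul_rpow hS.nonempty hc0 hc0' hc1 hc1' hH hh hlt
  have hmono : ∑' s : S, c0 ^ (((s : ℕ) : ℝ) * H) * c1 ^ H ≤
      ∑' s : S, cb0 ^ (((s : ℕ) : ℝ) * H) * cb1 ^ H :=
    Summable.tsum_le_tsum (fun s => by gcongr) (summable_rpow_mul_rpow S hc0 hc0' hH)
      (summable_rpow_mul_rpow S hcb0' hcb0 hH)
  simp only [hsum] at hanti
  linarith
end
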